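/- Let h > 1 and C > 0 be real numbers and let n be a natural number with n > h/(h−1) and hⁿ > C. Set α₀ = (hⁿ − C)/(2n hⁿ). Then 4(1 − α₀) C / (α₀ (1 − α₀)ⁿ hⁿ ((1 − α₀)ⁿ hⁿ − C)) ≤ 32 n hⁿ C / ((hⁿ − C)² (hⁿ + C)). -/

import Mathlib

/-- Main estimate of Lemma 4.1: the objective evaluated at the feasible point
`α₀ = (hⁿ - C)/(2n hⁿ)` is bounded by `32 n hⁿ C / ((hⁿ - C)² (hⁿ + C))`. -/
theorem zolotarev_stmt3
    (h C : ℝ) (hh : 1 < h) (hC : 0 < C) (n : ℕ)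
    (hn : (n : ℝ) > h / (h - 1)) (hhn : h ^ n > C) :
    4 * (1 - (h ^ n - C) / (2 * n * h ^ n)) * C /
        ((h ^ n - C) / (2 * n * h ^ n) * (1 - (h ^ n - C) / (2 * n * h ^ n)) ^ n * h ^ n *
          ((1 - (h ^ n - C) / (2 * n * h ^ n)) ^ n * h ^ n - C))
      ≤ 32 * n * h ^ n * C / ((h ^ n - C) ^ 2 * (h ^ n + C)) := by
  have hn0 : (0 : ℝ) < n := lt_trans (div_pos (by linarith) (by linarith)) hn
  have hn1 : (1 : ℝ) ≤ n := by exact_mod_cast hn0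
  generalize h ^ n = H at *
  have hH : 0 < H := hC.trans hhn
  have hHC : 0 < H - C := sub_pos.2 hhn
  set a := (H - C) / (2 * n * H) with ha
  have ha0 : 0 < a := by positivity
  have hnaH : n * a * H = (H - C) / 2 := by rw [ha]; field_simp
  have ha1 : a ≤ 1 := by
    rw [ha, div_le_one (by positivity)]
    nlinarith
  have hbern : 1 - n * a ≤ (1 - a) ^ n := by
    have := one_add_mul_le_pow (a := -a) (by linarith) n
    simpa [sub_eq_add_neg] using this
  have hpow : (H + C) / 2 ≤ (1 - a) ^ n * H := by
    have := mul_le_mul_of_nonneg_right hbern hH.le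
    linarith
  have hpow' : (H - C) / 2 ≤ (1 - a) ^ n * H - C := by linarith
  calc 4 * (1 - a) * C / (a * (1 - a) ^ n * H * ((1 - a) ^ n * H - C))
      = 4 * (1 - a) * C / (a * ((1 - a) ^ n * H) * ((1 - a) ^ n * H - C)) := by
        rw [mul_assoc a]
    _ ≤ 4 * 1 * C / (a * ((H + C) / 2) * ((H - C) / 2)) := by
        gcongr
        linarith
    _ = 32 * n * H * C / ((H - C) ^ 2 * (H + C)) := by
        rw [ha]
        field_simp
        norm_num
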